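/- Let k be an algebraically closed field, n₁, n₂ ≥ 1, and let X be a closed irreducible subvariety of ℙ^{n₁} × ℙ^{n₂} over k with canonical projections p₁, p₂. Let r₁, r₂ > 0 be integers and assume dim p₁(X) ≥ r₁ + 1, dim p₂(X) ≥ r₂ + 1 and dim X ≥ r₁ + r₂ + 2. Then for every choice of linear forms σ'₀,…,σ'_{r₁} on k^{n₁+1} and τ'₀,…,τ'_{r₂} on k^{n₂+1}, there exists a point (x₁, x₂) ∈ X with σ'_i(x₁) = 0 for all i = 0,…,r₁ and τ'_j(x₂) = 0 for all j = 0,…,r₂. Equivalently, X ∩ (M₁ × M₂) ≠ ∅, where M₁ ⊆ ℙ^{n₁} is the common zero locus of the σ'_i and M₂ ⊆ ℙ^{n₂} is the common zero locus of the τ'_j; hence the projection h : Z → Q from the incidence variety Z := {(x, [σ₀,…,σ_{r₁}], [τ₀,…,τ_{r₂}]) ∈ X × Q : σ_i(x) = τ_j(x) = 0 for all i, j} to Q := ℙ(V₁^{⊕(r₁+1)}) × ℙ(V₂^{⊕(r₂+1)}) is surjective. -/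

import Mathlib

/-!
The key surjectivity step in the proof of Theorem 3.1: if `X ⊆ ℙ^{n₁} × ℙ^{n₂}` is a
closed irreducible subvariety with `dim p₁(X) ≥ r₁ + 1`, `dim p₂(X) ≥ r₂ + 1` and
`dim X ≥ r₁ + r₂ + 2`, then for any linear forms `σ'₀, …, σ'_{r₁}` on `k^{n₁+1}` and
`τ'₀, …, τ'_{r₂}` on `k^{n₂+1}` there is a point `(x₁, x₂) ∈ X` with `σ'_i(x₁) = 0` and
`τ'_j(x₂) = 0` for all `i, j`; i.e. `X ∩ (M₁ × M₂) ≠ ∅`.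
-/

open AlgebraicGeometry CategoryTheory CategoryTheory.Limits MvPolynomial

attribute [local instance] MvPolynomial.gradedAlgebra

noncomputable section

/-- Projective `n`-space over `k`, as the `Proj` of the standard graded polynomial ring
`k[x₀, …, xₙ]`. -/
def ProjSpace (k : Type) [Field k] (n : ℕ) : Scheme :=
  Proj (homogeneousSubmodule (Fin (n + 1)) k)

/-- The structure morphism `ℙⁿ_k ⟶ Spec k`. -/
def ProjSpace.structMap (k : Type) [Field k] (n : ℕ) : ProjSpace k n ⟶ Spec (.of k) :=
  Proj.toSpecZero _ ≫ Spec.map (CommRingCat.ofHom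
    (algebraMap k (homogeneousSubmodule (Fin (n + 1)) k 0)))

/-- `ℙⁿ_k` as a scheme over `Spec k`. -/
abbrev ProjOver (k : Type) [Field k] (n : ℕ) : Over (Spec (CommRingCat.of k)) :=
  Over.mk (ProjSpace.structMap k n)

theorem Matroid.exists_subsets_indep_union {α : Type*} (M : Matroid α) {T S : Set α} {a b : ℕ}
    (hSb : b ≤ M.eRk S) (hTS : (a + b : ℕ) ≤ M.eRk (T ∪ S))
    (hTa : a ≤ M.eRk T) (hTE : T ∪ S ⊆ M.E) :
    ∃ I J : Set α, I ⊆ T ∧ J ⊆ S ∧ I.encard = a ∧ J.encard = b ∧ Disjoint I J ∧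
      M.Indep (I ∪ J) := by
  obtain ⟨I₀, hI₀⟩ := M.exists_isBasis T (Set.subset_union_left.trans hTE)
  obtain ⟨B, hB, hIB⟩ := hI₀.indep.subset_isBasis_of_subset
    (hI₀.subset.trans (Set.subset_union_left (t := S))) hTE
  have hdiff : B \ I₀ ⊆ S := by
    intro x hx
    rcases hB.subset hx.1 with h | h
    · exact absurd (hI₀.mem_of_insert_indep h
        (hB.indep.subset (Set.insert_subset hx.1 hIB))) hx.2
    · exact h
  rw [← hI₀.encard_eq_eRk] at hTa
  rw [← hB.encard_eq_eRk] at hTS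
  by_cases hb : (b : ℕ∞) ≤ (B \ I₀).encard
  · obtain ⟨I, hI, hIa⟩ := Set.exists_subset_encard_eq hTa
    obtain ⟨J, hJ, hJb⟩ := Set.exists_subset_encard_eq hb
    refine ⟨I, J, hI.trans hI₀.subset, hJ.trans hdiff, hIa, hJb, ?_, hB.indep.subset ?_⟩
    · exact (Set.disjoint_sdiff_right).mono hI hJ
    · exact Set.union_subset (hI.trans hIB) (hJ.trans Set.sdiff_subset)
  · obtain ⟨J₁, hJ₁, hJ₁'⟩ := (hB.indep.subset Set.sdiff_subset).subset_isBasis_of_subset hdiff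
      (Set.subset_union_right.trans hTE)
    rw [← hJ₁.encard_eq_eRk] at hSb
    obtain ⟨J, hJ', hJ, hJb⟩ := Set.exists_superset_subset_encard_eq hJ₁' (not_le.1 hb).le hSb
    have hJS := hJ.trans hJ₁.subset
    have hE : J ∪ I₀ ⊆ M.E := Set.union_subset (hJS.trans (Set.subset_union_right.trans hTE))
      hI₀.indep.subset_ground
    obtain ⟨D, hD, hJD⟩ := (hJ₁.indep.subset hJ).subset_isBasis_of_subset
      Set.subset_union_left hE
    have hBJ : B ⊆ J ∪ I₀ := fun x hx ↦ by
      by_cases hx' : x ∈ I₀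
      · exact Or.inr hx'
      · exact Or.inl (hJ' ⟨hx, hx'⟩)
    have hD' : (a + b : ℕ) ≤ D.encard := by
      rw [hD.encard_eq_eRk]
      exact hTS.trans (hB.indep.encard_le_eRk_of_subset hBJ)
    rw [← Set.encard_sdiff_add_encard_of_subset hJD, hJb, Nat.cast_add,
      ENat.add_le_add_iff_right (by simp)] at hD'
    obtain ⟨I, hI, hIa⟩ := Set.exists_subset_encard_eq hD'
    refine ⟨I, J, fun x hx ↦ ?_, hJS, hIa, hJb, Set.disjoint_sdiff_left.mono_left hI,
      hD.indep.subset (Set.union_subset (hI.trans Set.sdiff_subset) hJD)⟩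
    exact hI₀.subset ((hD.subset (hI hx).1).resolve_left (hI hx).2)

theorem Polynomial.coeff_prod_pow_of_natDegree_le {R ι : Type*} [CommSemiring R] (s : Finset ι)
    (f : ι → Polynomial R) (hf : ∀ i, (f i).natDegree ≤ 1) (d : ι → ℕ) :
    (∏ i ∈ s, f i ^ d i).natDegree ≤ ∑ i ∈ s, d i ∧
      (∏ i ∈ s, f i ^ d i).coeff (∑ i ∈ s, d i) = ∏ i ∈ s, (f i).coeff 1 ^ d i := by
  classical
  induction s using Finset.induction_on with
  | empty => simp
  | insert i s hi ih =>
    have h : (f i ^ d i).natDegree ≤ d i := by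
      simpa using Polynomial.natDegree_pow_le_of_le (d i) (hf i)
    have h' : (f i ^ d i).coeff (d i) = (f i).coeff 1 ^ d i := by
      simpa using Polynomial.coeff_pow_of_natDegree_le (m := d i) (hf i)
    rw [Finset.prod_insert hi, Finset.prod_insert hi, Finset.sum_insert hi]
    exact ⟨Polynomial.natDegree_mul_le_of_le h ih.1, by
      rw [Polynomial.coeff_mul_add_eq_of_natDegree_le h ih.1, ih.2, h']⟩

theorem MvPolynomial.coeff_aeval_of_isHomogeneous_of_natDegree_le {k F κ : Type*} [Field k]
    [Field F]
    [Algebra k F] [Fintype κ] {p : MvPolynomial κ k} {m : ℕ} (hp : p.IsHomogeneous m)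
    (f : κ → Polynomial F) (hf : ∀ i, (f i).natDegree ≤ 1) :
    (aeval f p).natDegree ≤ m ∧
      (aeval f p).coeff m = aeval (fun i ↦ (f i).coeff 1) p := by
  have hd (d) (h : d ∈ p.support) : ∑ i, d i = m := by
    have := hp (mem_support_iff.1 h)
    rwa [show (1 : κ → ℕ) = fun _ ↦ 1 from rfl, ← Finsupp.degree_eq_weight_one,
      Finsupp.degree_eq_sum] at this
  rw [aeval_def, eval₂_eq', aeval_def, eval₂_eq']
  have key (d) (h : d ∈ p.support) := Polynomial.coeff_prod_pow_of_natDegree_le Finset.univ f hf d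
  constructor
  · refine Polynomial.natDegree_sum_le_of_forall_le _ _ fun d h ↦ ?_
    rw [IsScalarTower.algebraMap_apply k F]
    refine (Polynomial.natDegree_C_mul_le _ _).trans ?_
    rw [← hd d h]
    exact (key d h).1
  · rw [Polynomial.finsetSum_coeff]
    refine Finset.sum_congr rfl fun d h ↦ ?_
    rw [IsScalarTower.algebraMap_apply k F (Polynomial F)]
    refine (Polynomial.coeff_C_mul _).trans ?_
    rw [← (key d h).2, hd d h]

theorem MvPolynomial.eq_zero_of_isHomogeneous_of_aeval_option {k F ι : Type*} [Field k]
    [Field F] [Algebra k F] [Fintype ι] {θ : ι → F} (hθ : AlgebraicIndependent k θ)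
    {p : MvPolynomial (Option ι) k} {m : ℕ} (hp : p.IsHomogeneous m)
    (h : aeval (fun o : Option ι ↦ o.elim 1 θ) p = 0) : p = 0 := by
  classical
  have hd (d) (h : coeff d p ≠ 0) : d none + ∑ i, d (some i) = m := by
    have := hp h
    rwa [show (1 : Option ι → ℕ) = fun _ ↦ 1 from rfl, ← Finsupp.degree_eq_weight_one,
      Finsupp.degree_eq_sum, Fintype.sum_option] at this
  have h0 : aeval (fun o : Option ι ↦ o.elim 1 (X : ι → MvPolynomial ι k)) p = 0 := by
    refine (injective_iff_map_eq_zero _).1 hθ _ ?_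
    rw [← h, ← AlgHom.comp_apply]
    congr 1
    ext (_ | i) <;> simp
  rw [aeval_def, eval₂_eq'] at h0
  by_contra hne
  obtain ⟨d, hd0⟩ := ne_zero_iff.1 hne
  have h1 := congr_arg (coeff d.some) h0
  rw [coeff_sum, Finset.sum_eq_single d] at h1
  · simp [Fintype.prod_option, algebraMap_eq, coeff_C_mul] at h1
    refine h1.elim hd0 fun h2 ↦ ?_
    have : ∏ i, (X i : MvPolynomial ι k) ^ d (some i) = monomial d.some 1 := by
      rw [monomial_eq, Finsupp.prod_fintype _ _ (by simp)]
      simp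
    simp [this] at h2
  · intro e he hed
    have : ∏ i, (X i : MvPolynomial ι k) ^ e (some i) = monomial e.some 1 := by
      rw [monomial_eq, Finsupp.prod_fintype _ _ (by simp)]
      simp
    simp only [algebraMap_eq, Fintype.prod_option, Option.elim, one_pow, one_mul, this, coeff_C_mul,
      coeff_monomial]
    rw [if_neg, mul_zero]
    intro heq
    refine hed (Finsupp.ext fun o ↦ ?_)
    have h2 (i : ι) : e (some i) = d (some i) := by simpa using DFunLike.congr_fun heq i
    have h3 := hd _ hd0
    have h4 := hd _ (mem_support_iff.1 he)
    simp only [h2] at h4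
    cases o with
    | none => omega
    | some i => exact h2 i
  · intro hh
    simp [notMem_support_iff.1 hh]

theorem AlgebraicIndependent.option_elim_linear {k F ι : Type*} [Field k] [Field F]
    [Algebra k F] [Fintype ι] {θ : ι → F} (hθ : AlgebraicIndependent k θ) (c : ι → F) :
    AlgebraicIndependent k (fun o : Option ι ↦ o.elim (Polynomial.X : Polynomial F)
      fun i ↦ Polynomial.X * Polynomial.C (θ i) + Polynomial.C (c i)) := by
  set f := (fun o : Option ι ↦ o.elim (Polynomial.X : Polynomial F)
      fun i ↦ Polynomial.X * Polynomial.C (θ i) + Polynomial.C (c i)) with hfdef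
  have hf (o) : (f o).natDegree ≤ 1 := by
    cases o with
    | none => simp [f]
    | some i =>
      simp only [f, Option.elim]
      compute_degree
  have hf1 : (fun o ↦ (f o).coeff 1) = fun o ↦ o.elim 1 θ := by
    ext (_ | i) <;> simp [f, Polynomial.coeff_C]
  rw [algebraicIndependent_iff]
  intro p hp
  by_contra hne
  have hlead : homogeneousComponent p.totalDegree p ≠ 0 := by
    obtain ⟨d, hd, hd'⟩ := Finset.exists_mem_eq_sup p.support
      (by simpa [Finset.nonempty_iff_ne_empty] using hne) (fun s ↦ s.sum fun _ e ↦ e)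
    refine ne_zero_iff.2 ⟨d, ?_⟩
    rw [coeff_homogeneousComponent, if_pos]
    · exact mem_support_iff.1 hd
    · exact hd'.symm
  refine hlead (eq_zero_of_isHomogeneous_of_aeval_option hθ
    (homogeneousComponent_isHomogeneous _ p) ?_)
  rw [← hf1, ← (coeff_aeval_of_isHomogeneous_of_natDegree_le
    (homogeneousComponent_isHomogeneous _ p) f hf).2]
  have h1 := congr_arg (Polynomial.coeff · p.totalDegree) hp
  rw [← sum_homogeneousComponent p, map_sum, Polynomial.finsetSum_coeff,
    Finset.sum_range_succ, Finset.sum_eq_zero, zero_add] at h1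
  · simpa [sum_homogeneousComponent] using h1
  · intro i hi
    refine Polynomial.coeff_eq_zero_of_natDegree_lt
      (((coeff_aeval_of_isHomogeneous_of_natDegree_le
        (homogeneousComponent_isHomogeneous _ p) f hf).1).trans_lt ?_)
    simpa [sum_homogeneousComponent] using hi

/-- Specialization of general linear equations: generic perturbations of the `c i` along
algebraically independent directions `θ i` can be made infinitesimal. -/
theorem AlgebraicIndependent.exists_valuationSubring {k F ι : Type} [Fintype ι] [Field k]
    [Field F] [Algebra k F] {θ : ι → F} (hθ : AlgebraicIndependent k θ) (c : ι → F) :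
    ∃ V : ValuationSubring (RatFunc F),
      (∀ x : k, algebraMap k (RatFunc F) x ∈ V) ∧ (RatFunc.X : RatFunc F) ∈ V.nonunits ∧
      ∀ i, RatFunc.X * algebraMap F (RatFunc F) (θ i) + algebraMap F (RatFunc F) (c i) ∈
        V.nonunits := by
  let w : Option ι → RatFunc F := fun o ↦ o.elim RatFunc.X
    fun i ↦ RatFunc.X * algebraMap F (RatFunc F) (θ i) + algebraMap F (RatFunc F) (c i)
  have hw : AlgebraicIndependent k w := by
    have := (hθ.option_elim_linear c).map'
      (f := IsScalarTower.toAlgHom k (Polynomial F) (RatFunc F))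
      (IsFractionRing.injective _ _)
    convert this using 1
    ext (_ | i)
    · simp [w]
    · simp [w, ← RatFunc.algebraMap_C]
      exact mul_comm _ _
  let g : Algebra.adjoin k (Set.range w) →+* k :=
    (constantCoeff : MvPolynomial (Option ι) k →+* k).comp
      (hw.aevalEquiv.symm : _ →+* MvPolynomial (Option ι) k)
  obtain ⟨V, hV, hV'⟩ := Ideal.image_subset_nonunits_valuationSubring
    (A := (Algebra.adjoin k (Set.range w)).toSubring) (RingHom.ker g) (RingHom.ker_ne_top g)
  have key (o) : w o ∈ V.nonunits := by
    have hm : w o ∈ Algebra.adjoin k (Set.range w) := Algebra.subset_adjoin ⟨o, rfl⟩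
    refine hV' ⟨⟨w o, hm⟩, ?_, rfl⟩
    have : hw.aevalEquiv.symm ⟨w o, hm⟩ = X o := by
      rw [AlgEquiv.symm_apply_eq]
      ext
      simp
    simp [g, RingHom.mem_ker, this]
  exact ⟨V, fun x ↦ hV (Subalgebra.algebraMap_mem _ x), key none, fun i ↦ key (some i)⟩

theorem ringKrullDim_le_of_isIntegral {R S : Type*} [CommRing R] [CommRing S] [Algebra R S]
    [Algebra.IsIntegral R S] : ringKrullDim S ≤ ringKrullDim R := by
  refine Order.krullDim_le_of_strictMono (PrimeSpectrum.comap (algebraMap R S)) fun p q h ↦ ?_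
  exact Ideal.IsIntegral.comap_lt_comap h

theorem exists_algebraicIndependent_of_le_ringKrullDim {k B : Type*} [Field k] [CommRing B]
    [IsDomain B] [Algebra k B] [Algebra.FiniteType k B] {N : ℕ}
    (h : (N : WithBot ℕ∞) ≤ ringKrullDim B) :
    ∃ x : Fin N → B, AlgebraicIndependent k x := by
  obtain ⟨s, g, hg, hint⟩ := exists_integral_inj_algHom_of_fg k B
  have hs : N ≤ s := by
    algebraize [g.toRingHom]
    have : Algebra.IsIntegral (MvPolynomial (Fin s) k) B := ⟨hint⟩
    have := h.trans (ringKrullDim_le_of_isIntegral (R := MvPolynomial (Fin s) k))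
    rw [MvPolynomial.ringKrullDim_of_isNoetherianRing] at this
    simpa using this
  exact ⟨_, (((MvPolynomial.algebraicIndependent_X (Fin s) k).map' hg).comp _
    (Fin.castLE_injective hs))⟩

theorem exists_algebraicIndependent_of_le_krullDim_zeroLocus_ker {k A E : Type*} [Field k]
    [CommRing A] [Algebra k A] [Algebra.FiniteType k A] [Field E] [Algebra k E] (φ : A →ₐ[k] E)
    {N : ℕ} (h : (N : WithBot ℕ∞) ≤
      Order.krullDim (PrimeSpectrum.zeroLocus (RingHom.ker φ : Set A))) :
    ∃ x : Fin N → E, AlgebraicIndependent k x := by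
  rw [← ringKrullDim_quotient] at h
  have : (RingHom.ker φ).IsPrime := RingHom.ker_isPrime φ.toRingHom
  obtain ⟨x, hx⟩ := exists_algebraicIndependent_of_le_ringKrullDim (k := k) h
  exact ⟨_, hx.map' (f := Ideal.kerLiftAlg φ) (Ideal.kerLiftAlg_injective φ)⟩

theorem exists_specializes_chain_of_le_topologicalKrullDim {Y : Type*} [TopologicalSpace Y]
    [QuasiSober Y] {N : ℕ} (h : (N : WithBot ℕ∞) ≤ topologicalKrullDim Y) :
    ∃ g : Fin (N + 1) → Y, ∀ i j, i < j → g j ⤳ g i ∧ ¬ g i ⤳ g j := by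
  obtain ⟨l, rfl⟩ := Order.le_krullDim_iff.1 h
  have hg (i) : closure {(l i).2.genericPoint} = (l i : Set Y) :=
    (l i).2.genericPoint_closure_eq.trans (l i).3.closure_eq
  refine ⟨fun i ↦ (l i).2.genericPoint, fun i j hij ↦ ?_⟩
  have := l.strictMono hij
  simp only [specializes_iff_closure_subset, hg]
  exact ⟨this.le, this.not_ge⟩

/-- The dimension of the closure of an `E`-valued point is at most the transcendence degree
of `E`. -/
theorem AlgebraicGeometry.exists_algebraicIndependent_of_le_topologicalKrullDim {k E : Type}
    [Field k] [Field E] [Algebra k E] {T : Scheme.{0}} (f : T ⟶ Spec (.of k))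
    [LocallyOfFiniteType f] (q : Spec (.of E) ⟶ T)
    (hq : q ≫ f = Spec.map (CommRingCat.ofHom (algebraMap k E)))
    (e : Spec (.of E)) {N : ℕ}
    (h : (N : WithBot ℕ∞) ≤ topologicalKrullDim (closure {q e})) :
    ∃ x : Fin N → E, AlgebraicIndependent k x := by
  have : QuasiSober (closure {q e}) :=
    isClosed_closure.isClosedEmbedding_subtypeVal.quasiSober
  obtain ⟨g, hg⟩ := exists_specializes_chain_of_le_topologicalKrullDim h
  obtain ⟨R, j, hj, ⟨y₀, hy₀⟩⟩ := Scheme.exists_Spec_apply_eq (g 0 : T)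
  have hg0 (i) : (g i : T) ⤳ g 0 := by
    rcases (Fin.zero_le i).eq_or_lt with rfl | hi
    · exact specializes_rfl
    · exact (hg _ _ hi).1.map continuous_subtype_val
  have hjr {t : T} (ht : t ⤳ g 0) : t ∈ Set.range j :=
    ht.mem_open j.isOpenEmbedding.isOpen_range ⟨y₀, hy₀⟩
  choose y hy using fun i ↦ hjr (hg0 i)
  have hqg (i) : q e ⤳ g i := specializes_iff_mem_closure.2 (g i).2
  have hq' : Set.range q ⊆ Set.range j := by
    rintro _ ⟨e', rfl⟩
    obtain rfl := Subsingleton.elim e e'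
    exact hjr (hqg 0)
  obtain ⟨φ, hφ⟩ := Spec.map_surjective (IsOpenImmersion.lift j q hq')
  have hφq : Spec.map φ ≫ j = q := by rw [hφ, IsOpenImmersion.lift_fac]
  obtain ⟨ψ, hψ⟩ := Spec.map_surjective (j ≫ f)
  algebraize [ψ.hom]
  have hft : LocallyOfFiniteType (Spec.map ψ) := hψ ▸ inferInstance
  have : Algebra.FiniteType k R := HasRingHomProperty.Spec_iff.mp hft
  let φ' : R →ₐ[k] E :=
    { φ.hom with
      commutes' := fun r ↦ by
        have h1 : ψ ≫ φ = CommRingCat.ofHom (algebraMap k E) := by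
          apply Spec.map_injective
          rw [Spec.map_comp, hψ, reassoc_of% hφq, hq]
        exact DFunLike.congr_fun (congr_arg CommRingCat.Hom.hom h1) r }
  have hspec {a b} : y a ⤳ y b ↔ g a ⤳ g b := by
    rw [← j.isOpenEmbedding.isInducing.specializes_iff, hy, hy, subtype_specializes_iff]
  have hker : (Spec.map φ e).asIdeal = RingHom.ker φ' := by
    have he : e.asIdeal = ⊥ := (Ideal.eq_bot_or_top e.asIdeal).resolve_right e.2.ne_top
    change Ideal.comap φ.hom e.asIdeal = _
    rw [he]
    rfl
  have hmem (i) : y i ∈ PrimeSpectrum.zeroLocus (RingHom.ker φ' : Set R) := by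
    rw [← hker]
    have : Spec.map φ e ⤳ y i := by
      rw [← j.isOpenEmbedding.isInducing.specializes_iff, hy, ← Scheme.Hom.comp_apply, hφq]
      exact hqg i
    exact (PrimeSpectrum.le_iff_specializes _ _).2 this
  refine exists_algebraicIndependent_of_le_krullDim_zeroLocus_ker φ' ?_
  refine Order.le_krullDim_iff.2 ⟨⟨N, fun i ↦ ⟨y i.rev, hmem _⟩, fun i ↦ ?_⟩, rfl⟩
  have := hg i.succ.rev i.castSucc.rev (by simp [Fin.rev_lt_rev])
  rw [← hspec, ← hspec] at this
  exact lt_of_le_not_ge ((PrimeSpectrum.le_iff_specializes _ _).2 this.1)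
    (fun h ↦ this.2 ((PrimeSpectrum.le_iff_specializes _ _).1 h))

section
open HomogeneousLocalization

section evalAway
variable {A S S' σ : Type} [CommRing A] [SetLike σ A] [AddSubgroupClass σ A] [CommRing S]
  [CommRing S'] (𝒜 : ℕ → σ) [GradedRing 𝒜] (g : A →+* S) {x : A}

/-- The ring homomorphism `(A_x)₀ →+* S` induced by `g : A →+* S` with `g x` a unit. -/
def HomogeneousLocalization.Away.eval (h : IsUnit (g x)) :
    Away 𝒜 x →+* S :=
  (IsLocalization.Away.lift (S := Localization.Away x) x h).comp
    (algebraMap (Away 𝒜 x) (Localization.Away x))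

theorem HomogeneousLocalization.Away.eval_mk_mul_pow (h : IsUnit (g x)) {d : ℕ} (hx : x ∈ 𝒜 d)
    (n : ℕ) (a : A) (ha : a ∈ 𝒜 (n • d)) :
    Away.eval 𝒜 g h (Away.mk 𝒜 hx n a ha) * g x ^ n = g a := by
  rw [Away.eval, RingHom.comp_apply, HomogeneousLocalization.algebraMap_apply, Away.val_mk,
    ← map_pow, ← IsLocalization.Away.lift_eq (S := Localization.Away x) x h (x ^ n), ← map_mul,
    Localization.mk_eq_mk']
  rw [IsLocalization.mk'_spec' _ _ (⟨x ^ n, n, rfl⟩ : Submonoid.powers x) |> (mul_comm _ _).trans]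
  exact IsLocalization.Away.lift_eq ..

theorem HomogeneousLocalization.Away.eval_eq_of_forall {d : ℕ} (hx : x ∈ 𝒜 d)
    (h : IsUnit (g x)) (φ : Away 𝒜 x →+* S)
    (hφ : ∀ n a ha, φ (Away.mk 𝒜 hx n a ha) * g x ^ n = g a) : Away.eval 𝒜 g h = φ := by
  ext z
  obtain ⟨n, a, ha, rfl⟩ := Away.mk_surjective 𝒜 hx z
  apply (h.pow n).mul_right_cancel
  rw [hφ, Away.eval_mk_mul_pow]

theorem HomogeneousLocalization.Away.comp_eval (h : IsUnit (g x)) (ψ : S →+* S') :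
    ψ.comp (Away.eval 𝒜 g h) = Away.eval 𝒜 (ψ.comp g) (h.map ψ) := by
  rw [Away.eval, Away.eval, ← RingHom.comp_assoc]
  congr 1
  apply IsLocalization.ringHom_ext (M := .powers x)
  ext
  simp

theorem HomogeneousLocalization.Away.eval_comp_awayMap {y z : A} (hz : z = x * y)
    {d e : ℕ} (hx : x ∈ 𝒜 d) (hy : y ∈ 𝒜 e) (h : IsUnit (g x)) (h' : IsUnit (g z)) :
    (Away.eval 𝒜 g h').comp (awayMap 𝒜 hy hz) = Away.eval 𝒜 g h := by
  symm
  apply Away.eval_eq_of_forall 𝒜 g hx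
  intro n a ha
  rw [RingHom.comp_apply, awayMap_mk]
  have hy' : IsUnit (g y) := by
    rw [hz, map_mul] at h'
    exact isUnit_of_mul_isUnit_right h'
  apply (hy'.pow n).mul_right_cancel
  have := Away.eval_mk_mul_pow 𝒜 g h' (hz ▸ SetLike.mul_mem_graded hx hy) n (a * y ^ n)
    (by
      rw [smul_add]
      exact SetLike.mul_mem_graded ha (SetLike.pow_mem_graded n hy))
  rw [map_mul, map_pow] at this
  rw [← this, mul_assoc, ← mul_pow, ← map_mul]
  exact congr_arg (fun t ↦ _ * g t ^ n) hz.symm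
end evalAway

namespace AlgebraicGeometry.Proj
variable {A S S' σ : Type} [CommRing A] [SetLike σ A] [AddSubgroupClass σ A] [CommRing S]
  [CommRing S'] (𝒜 : ℕ → σ) [GradedRing 𝒜] (g : A →+* S) {x : A}

/-- The morphism `Spec S ⟶ Proj 𝒜` determined by `g : A →+* S` with `g x` a unit for some
homogeneous `x` of positive degree. -/
def ofUnit {d : ℕ} (hx : x ∈ 𝒜 d) (hd : 0 < d) (h : IsUnit (g x)) : Spec (.of S) ⟶ Proj 𝒜 :=
  Spec.map (CommRingCat.ofHom (Away.eval 𝒜 g h)) ≫ awayι 𝒜 x hx hd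

variable {d : ℕ} (hx : x ∈ 𝒜 d) (hd : 0 < d) (h : IsUnit (g x))

theorem ofUnit_mul {y z : A} (hz : z = x * y) {e : ℕ} (hy : y ∈ 𝒜 e) (h' : IsUnit (g z)) :
    ofUnit 𝒜 g (x := z) (hz ▸ SetLike.mul_mem_graded hx hy) (hd.trans_le (d.le_add_right e)) h' =
      ofUnit 𝒜 g hx hd h := by
  rw [ofUnit, ofUnit, ← SpecMap_awayMap_awayι 𝒜 hx hd hy hz, ← Spec.map_comp_assoc,
    ← CommRingCat.ofHom_comp, Away.eval_comp_awayMap 𝒜 g hz hx hy h]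

theorem ofUnit_eq_of_scale {g' : A →+* S} (u : S) (hg : ∀ n, ∀ a ∈ 𝒜 n, g' a = u ^ n * g a)
    (h' : IsUnit (g' x)) : ofUnit 𝒜 g hx hd h = ofUnit 𝒜 g' hx hd h' := by
  rw [ofUnit, ofUnit, Away.eval_eq_of_forall 𝒜 g hx h (Away.eval 𝒜 g' h')]
  intro n a ha
  have hu : IsUnit (u ^ d) := by
    rw [hg _ _ hx] at h'
    exact isUnit_of_mul_isUnit_left h'
  have := Away.eval_mk_mul_pow 𝒜 g' h' hx n a ha
  rw [hg _ _ hx, hg _ _ ha, mul_pow, ← pow_mul, smul_eq_mul, mul_comm n d, pow_mul,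
    mul_left_comm] at this
  exact (hu.pow n).mul_left_cancel this

theorem ofUnit_eq_ofUnit {g' : A →+* S} (u : S) (hg : ∀ n, ∀ a ∈ 𝒜 n, g' a = u ^ n * g a)
    {y : A} {e : ℕ} (hy : y ∈ 𝒜 e) (he : 0 < e) (h' : IsUnit (g' y)) (h'' : IsUnit (g' x)) :
    ofUnit 𝒜 g hx hd h = ofUnit 𝒜 g' hy he h' := by
  rw [ofUnit_eq_of_scale 𝒜 g hx hd h u hg h'',
    ← ofUnit_mul 𝒜 g' hx hd h'' rfl hy (by simpa using h''.mul h'),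
    ← ofUnit_mul 𝒜 g' hy he h' (mul_comm x y) hx (by simpa using h''.mul h')]
  congr 1
  exact add_comm _ _

theorem specMap_ofUnit (ψ : S →+* S') :
    Spec.map (CommRingCat.ofHom ψ) ≫ ofUnit 𝒜 g hx hd h =
      ofUnit 𝒜 (ψ.comp g) hx hd (h.map ψ) := by
  rw [ofUnit, ofUnit, ← Spec.map_comp_assoc, ← CommRingCat.ofHom_comp, Away.comp_eval]

theorem ofUnit_toSpecZero :
    ofUnit 𝒜 g hx hd h ≫ toSpecZero 𝒜 =
      Spec.map (CommRingCat.ofHom (g.comp (algebraMap (𝒜 0) A))) := by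
  rw [ofUnit, Category.assoc, awayι_toSpecZero, ← Spec.map_comp, ← CommRingCat.ofHom_comp]
  congr 2
  ext a
  have := Away.eval_mk_mul_pow 𝒜 g h hx 0 a (by simp)
  rw [pow_zero, mul_one] at this
  rw [RingHom.comp_apply, RingHom.comp_apply, SetLike.GradeZero.algebraMap_apply, ← this]
  congr 1
  apply val_injective
  rw [Away.val_mk]
  simp only [pow_zero]
  rfl

theorem mem_asHomogeneousIdeal_ofUnit_iff {y : A} {e : ℕ} (hy : y ∈ 𝒜 e) (he : 0 < e)
    (z : Spec (.of S)) :
    y ∈ (ofUnit 𝒜 g hx hd h z).asHomogeneousIdeal ↔ g y ∈ z.asIdeal := by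
  rw [← not_iff_not]
  have h1 : ofUnit 𝒜 g hx hd h z ∈ basicOpen 𝒜 y ↔
      Spec.map (CommRingCat.ofHom (Away.eval 𝒜 g h)) z ∈ awayι 𝒜 x hx hd ⁻¹ᵁ basicOpen 𝒜 y :=
    Iff.rfl
  rw [← mem_basicOpen, h1, awayι_preimage_basicOpen 𝒜 hx hd hy he]
  change ¬ Away.eval 𝒜 g h _ ∈ z.asIdeal ↔ _
  have := Away.eval_mk_mul_pow 𝒜 g h hx e (y ^ d) (by
    convert! SetLike.pow_mem_graded d hy using 2; exact mul_comm _ _)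
  rw [← Ideal.mul_unit_mem_iff_mem _ (h.pow e), this, map_pow, z.2.pow_mem_iff_mem _ hd]

end AlgebraicGeometry.Proj
end

section

theorem MvPolynomial.eval₂_mul_of_isHomogeneous {k S ι : Type} [CommSemiring k] [CommSemiring S]
    {p : MvPolynomial ι k} {n : ℕ} (hp : p.IsHomogeneous n) (f : k →+* S) (u : S) (t : ι → S) :
    eval₂ f (fun l ↦ u * t l) p = u ^ n * eval₂ f t p := by
  rw [eval₂_eq, eval₂_eq, Finset.mul_sum]
  refine Finset.sum_congr rfl fun d hd ↦ ?_
  have : ∑ i ∈ d.support, d i = n := by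
    simpa [Finsupp.weight_apply, Finsupp.sum] using hp (mem_support_iff.1 hd)
  simp only [mul_pow, Finset.prod_mul_distrib, Finset.prod_pow_eq_pow_sum, this]
  ring

namespace ProjSpace
open HomogeneousLocalization

variable {k : Type} [Field k] {n : ℕ} {S S' : Type} [CommRing S] [Algebra k S] [CommRing S']
  [Algebra k S']

theorem X_mem (j : Fin (n + 1)) : X j ∈ homogeneousSubmodule (Fin (n + 1)) k 1 :=
  isHomogeneous_X k j

/-- The `S`-point of projective space with homogeneous coordinates `t`, one of which is a unit. -/
def pt (t : Fin (n + 1) → S) (j : Fin (n + 1)) (h : IsUnit (t j)) :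
    Spec (.of S) ⟶ ProjSpace k n :=
  Proj.ofUnit (homogeneousSubmodule (Fin (n + 1)) k)
    (aeval t : MvPolynomial (Fin (n + 1)) k →ₐ[k] S).toRingHom (x := X j)
    (X_mem j) one_pos (by simpa using h)

theorem pt_eq_pt {t t' : Fin (n + 1) → S} (u : S) (ht : ∀ l, t' l = u * t l) {i j : Fin (n + 1)}
    (hi : IsUnit (t i)) (hi' : IsUnit (t' i)) (hj : IsUnit (t' j)) :
    (pt t i hi : _ ⟶ ProjSpace k n) = pt t' j hj := by
  refine Proj.ofUnit_eq_ofUnit _ _ _ _ _ u (fun n a ha ↦ ?_) _ _ _ (by simpa using hi')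
  obtain rfl := funext ht
  exact eval₂_mul_of_isHomogeneous ha _ u t

theorem specMap_pt (ψ : S →ₐ[k] S') (t : Fin (n + 1) → S) (j : Fin (n + 1)) (h : IsUnit (t j)) :
    Spec.map (CommRingCat.ofHom ψ.toRingHom) ≫ pt t j h =
      (pt (fun l ↦ ψ (t l)) j (h.map ψ) : _ ⟶ ProjSpace k n) := by
  have : (ψ.toRingHom.comp (aeval t : MvPolynomial (Fin (n + 1)) k →ₐ[k] S).toRingHom) =
      (aeval (fun l ↦ ψ (t l)) : MvPolynomial (Fin (n + 1)) k →ₐ[k] S').toRingHom :=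
    congr_arg AlgHom.toRingHom (comp_aeval t ψ)
  simp only [pt, ← this]
  exact Proj.specMap_ofUnit ..

theorem pt_structMap (t : Fin (n + 1) → S) (j : Fin (n + 1)) (h : IsUnit (t j)) :
    pt t j h ≫ structMap k n = Spec.map (CommRingCat.ofHom (algebraMap k S)) := by
  have := Proj.ofUnit_toSpecZero (homogeneousSubmodule (Fin (n + 1)) k)
    (aeval t : MvPolynomial (Fin (n + 1)) k →ₐ[k] S).toRingHom (x := X j)
    (X_mem j) one_pos (by simpa using h)
  refine ((Category.assoc _ _ _).symm.trans (congr_arg (· ≫ _) this)).trans ?_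
  rw [← Spec.map_comp, ← CommRingCat.ofHom_comp]
  congr 2
  ext a
  exact (aeval t : MvPolynomial (Fin (n + 1)) k →ₐ[k] S).commutes a

theorem mem_asHomogeneousIdeal_pt_iff (t : Fin (n + 1) → S) (j : Fin (n + 1)) (h : IsUnit (t j))
    {p : MvPolynomial (Fin (n + 1)) k} (hp : p.IsHomogeneous 1) (z : Spec (.of S)) :
    p ∈ ((pt t j h : _ ⟶ ProjSpace k n) z).asHomogeneousIdeal ↔ aeval t p ∈ z.asIdeal :=
  Proj.mem_asHomogeneousIdeal_ofUnit_iff (homogeneousSubmodule (Fin (n + 1)) k)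
    (aeval t : MvPolynomial (Fin (n + 1)) k →ₐ[k] S).toRingHom (x := X j)
    (X_mem j) one_pos (by simpa using h) hp one_pos z

variable (k) in
/-- The standard affine chart of projective space. -/
def chart (j : Fin (n + 1)) :
    Spec (.of (Away (homogeneousSubmodule (Fin (n + 1)) k) (X j))) ⟶ ProjSpace k n :=
  Proj.awayι (homogeneousSubmodule (Fin (n + 1)) k) (X j) (X_mem j) one_pos

instance (j : Fin (n + 1)) : IsOpenImmersion (chart k j) :=
  inferInstanceAs (IsOpenImmersion (Proj.awayι (homogeneousSubmodule (Fin (n + 1)) k) (X j)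
    (X_mem j) one_pos))

theorem chart_structMap (j : Fin (n + 1)) : chart k j ≫ structMap k n =
    Spec.map (CommRingCat.ofHom ((fromZeroRingHom (homogeneousSubmodule (Fin (n + 1)) k)
      (.powers (X j))).comp (algebraMap k (homogeneousSubmodule (Fin (n + 1)) k 0)))) := by
  have := Proj.awayι_toSpecZero (homogeneousSubmodule (Fin (n + 1)) k) (X j)
    (X_mem j) one_pos
  refine ((Category.assoc _ _ _).symm.trans (congr_arg (· ≫ _) this)).trans ?_
  rw [← Spec.map_comp, ← CommRingCat.ofHom_comp]

theorem adjoin_range_X_eq_top : Algebra.adjoin (homogeneousSubmodule (Fin (n + 1)) k 0)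
    (Set.range (X : Fin (n + 1) → MvPolynomial (Fin (n + 1)) k)) = ⊤ := by
  rw [eq_top_iff]
  intro p _
  induction p using MvPolynomial.induction_on with
  | C a =>
    exact Subalgebra.algebraMap_mem _
      (⟨C a, isHomogeneous_C _ a⟩ : homogeneousSubmodule (Fin (n + 1)) k 0)
  | add p q hp hq => exact add_mem (hp trivial) (hq trivial)
  | mul_X p i hp => exact mul_mem (hp trivial) (Algebra.subset_adjoin ⟨i, rfl⟩)

theorem exists_mem_range_chart (x : ProjSpace k n) :
    ∃ j : Fin (n + 1), x ∈ Set.range (chart k j) := by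
  have h : ⨆ j : Fin (n + 1), Proj.basicOpen (homogeneousSubmodule (Fin (n + 1)) k) (X j) = ⊤ := by
    exact Proj.iSup_basicOpen_eq_top' (homogeneousSubmodule (Fin (n + 1)) k) _
      (fun j ↦ ⟨1, X_mem j⟩)
      adjoin_range_X_eq_top
  obtain ⟨j, hj⟩ := TopologicalSpace.Opens.mem_iSup.1 (h.ge (Set.mem_univ x))
  refine ⟨j, ?_⟩
  rw [← Proj.opensRange_awayι _ (X j) (X_mem j) one_pos] at hj
  exact hj

theorem away_mk_eq_eval₂ (j : Fin (n + 1)) {d : ℕ} {p : MvPolynomial (Fin (n + 1)) k}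
    (hp : p ∈ homogeneousSubmodule (Fin (n + 1)) k (d • 1)) :
    Away.mk (homogeneousSubmodule (Fin (n + 1)) k) (X_mem j) d p hp =
      eval₂ ((fromZeroRingHom (homogeneousSubmodule (Fin (n + 1)) k) (.powers (X j))).comp
        (algebraMap k (homogeneousSubmodule (Fin (n + 1)) k 0)))
      (fun l ↦ Away.mk (homogeneousSubmodule (Fin (n + 1)) k) (X_mem j) 1 (X l)
        (X_mem l)) p := by
  let L := Localization.Away (X j : MvPolynomial (Fin (n + 1)) k)
  let g := algebraMap (Away (homogeneousSubmodule (Fin (n + 1)) k) (X j)) L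
  have hmul (d : ℕ) (p : MvPolynomial (Fin (n + 1)) k)
      (hp : p ∈ homogeneousSubmodule (Fin (n + 1)) k (d • 1)) :
      algebraMap (MvPolynomial (Fin (n + 1)) k) L (X j) ^ d *
      g (Away.mk (homogeneousSubmodule (Fin (n + 1)) k) (X_mem j) d p hp) =
      algebraMap (MvPolynomial (Fin (n + 1)) k) L p := by
    rw [HomogeneousLocalization.algebraMap_apply, Away.val_mk, Localization.mk_eq_mk', ← map_pow]
    exact IsLocalization.mk'_spec' L p (⟨X j ^ d, d, rfl⟩ : Submonoid.powers (X j))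
  have hg : Function.Injective g := fun a b hab ↦ val_injective _
    ((HomogeneousLocalization.algebraMap_apply a).symm.trans
      (hab.trans (HomogeneousLocalization.algebraMap_apply b)))
  apply hg
  have hu : IsUnit (algebraMap (MvPolynomial (Fin (n + 1)) k) L (X j) ^ d) :=
    (IsLocalization.Away.algebraMap_isUnit (X j)).pow d
  apply hu.mul_left_cancel
  rw [hmul, hom_eval₂, ← eval₂_mul_of_isHomogeneous (n := d) (by simpa using hp)]
  have h2 (l) : algebraMap (MvPolynomial (Fin (n + 1)) k) L (X j) *
      g (Away.mk (homogeneousSubmodule (Fin (n + 1)) k) (X_mem j) 1 (X l) (X_mem l)) =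
      algebraMap (MvPolynomial (Fin (n + 1)) k) L (X l) := by
    rw [← hmul 1 (X l) (X_mem l), pow_one]
  rw [funext h2]
  conv_lhs => rw [← eval₂_eta p, hom_eval₂]
  congr 1

/-- Points of projective space with values in a field have homogeneous coordinates. -/
theorem exists_eq_pt {F : Type} [Field F] [Algebra k F] (q : Spec (.of F) ⟶ ProjSpace k n)
    (hq : q ≫ structMap k n = Spec.map (CommRingCat.ofHom (algebraMap k F))) :
    ∃ (t : Fin (n + 1) → F) (j : Fin (n + 1)) (h : IsUnit (t j)), t j = 1 ∧ q = pt t j h := by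
  let e : Spec (.of F) := IsLocalRing.closedPoint F
  obtain ⟨j, hj⟩ := exists_mem_range_chart (q e)
  have hq' : Set.range q ⊆ Set.range (chart k j) := by
    rintro _ ⟨e', rfl⟩
    obtain rfl := Subsingleton.elim e e'
    exact hj
  obtain ⟨φ, hφ⟩ := Spec.map_surjective (IsOpenImmersion.lift _ q hq')
  have hφq : Spec.map φ ≫ chart k j = q := by rw [hφ, IsOpenImmersion.lift_fac]
  let t (l : Fin (n + 1)) : F := φ.hom (Away.mk (homogeneousSubmodule (Fin (n + 1)) k)
    (X_mem j) 1 (X l) (X_mem l))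
  have htj : t j = 1 := by
    refine Eq.trans ?_ (map_one φ.hom)
    refine congr_arg φ.hom (val_injective _ ?_)
    rw [Away.val_mk, val_one]
    simp only [pow_one]
    exact Localization.mk_self
      (⟨X j, 1, pow_one _⟩ : Submonoid.powers (X j : MvPolynomial (Fin (n + 1)) k))
  have hk : φ.hom.comp ((fromZeroRingHom (homogeneousSubmodule (Fin (n + 1)) k)
      (.powers (X j))).comp (algebraMap k (homogeneousSubmodule (Fin (n + 1)) k 0))) =
      algebraMap k F := by
    rw [← hφq, Category.assoc, chart_structMap, ← Spec.map_comp] at hq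
    exact congr_arg CommRingCat.Hom.hom (Spec.map_injective hq)
  have htu : IsUnit (t j) := htj ▸ isUnit_one
  refine ⟨t, j, htu, htj, ?_⟩
  have := Away.eval_eq_of_forall (homogeneousSubmodule (Fin (n + 1)) k)
    (aeval t : MvPolynomial (Fin (n + 1)) k →ₐ[k] F).toRingHom (X_mem j)
    (by simpa using htu) φ.hom (fun d p hp ↦ by
      rw [away_mk_eq_eval₂, hom_eval₂, hk]
      simp [htj, aeval_def]
      rfl)
  rw [← hφq]
  exact congr_arg (fun ψ ↦ Spec.map (CommRingCat.ofHom ψ) ≫ chart k j) this.symm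

instance : LocallyOfFiniteType (structMap k n) := by
  have : Algebra.FiniteType (homogeneousSubmodule (Fin (n + 1)) k 0)
      (MvPolynomial (Fin (n + 1)) k) :=
    ⟨Subalgebra.fg_def.2 ⟨_, Set.finite_range _, adjoin_range_X_eq_top⟩⟩
  have hs : Function.Surjective (algebraMap k (homogeneousSubmodule (Fin (n + 1)) k 0)) := by
    rintro ⟨p, hp⟩
    refine ⟨constantCoeff p, Subtype.ext ?_⟩
    exact (totalDegree_eq_zero_iff_eq_C.1 (Nat.le_zero.1 (IsHomogeneous.totalDegree_le hp))).symm
  have : LocallyOfFiniteType (Spec.map (CommRingCat.ofHom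
      (algebraMap k (homogeneousSubmodule (Fin (n + 1)) k 0)))) :=
    HasRingHomProperty.Spec_iff.mpr (RingHom.FiniteType.of_surjective _ hs)
  have : LocallyOfFiniteType (Proj.toSpecZero (homogeneousSubmodule (Fin (n + 1)) k)) :=
    inferInstance
  exact MorphismProperty.comp_mem _ _ _ ‹_› ‹_›

end ProjSpace
end

theorem AlgebraicIndependent.le_eRk_of_intermediateField {k F : Type} [Field k] [Field F]
    [Algebra k F] {S : Set F} {N : ℕ} {x : Fin N → IntermediateField.adjoin k S}
    (hx : AlgebraicIndependent k x) : (N : ℕ∞) ≤ (AlgebraicIndependent.matroid k F).eRk S := by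
  have hy := hx.map' (f := (IntermediateField.adjoin k S).val) Subtype.val_injective
  have hr : (matroid k F).Indep (Set.range ((IntermediateField.adjoin k S).val ∘ x)) :=
    matroid_indep_iff.2 hy.to_subtype_range
  have hsub : Set.range ((IntermediateField.adjoin k S).val ∘ x) ⊆ (matroid k F).closure S := by
    rintro _ ⟨i, rfl⟩
    rw [matroid_closure_eq, SetLike.mem_coe, Subalgebra.mem_algebraicClosure]
    obtain ⟨r, hr, s, hs, h⟩ := IntermediateField.mem_adjoin_iff_div.1 (x i).2
    have hA {r : F} (hr : r ∈ Algebra.adjoin k S) : IsAlgebraic (Algebra.adjoin k S) r :=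
      isAlgebraic_algebraMap (⟨r, hr⟩ : Algebra.adjoin k S)
    simp only [Function.comp_apply, IntermediateField.coe_val, h, div_eq_mul_inv]
    exact (hA hr).mul (hA hs).inv
  rw [← Matroid.eRk_closure_eq]
  refine le_trans ?_ ((matroid k F).eRk_mono hsub)
  rw [hr.eRk_eq_encard]
  simpa using hy.injective.encard_range

theorem AlgebraicGeometry.le_eRk_of_le_topologicalKrullDim {k F : Type} [Field k] [Field F]
    [Algebra k F] {T : Scheme.{0}} (f : T ⟶ Spec (.of k)) [LocallyOfFiniteType f] (S : Set F)
    (q : Spec (.of (IntermediateField.adjoin k S)) ⟶ T)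
    (hq : q ≫ f = Spec.map (CommRingCat.ofHom (algebraMap k (IntermediateField.adjoin k S))))
    (q' : Spec (.of F) ⟶ T)
    (hq' : Spec.map (CommRingCat.ofHom (algebraMap (IntermediateField.adjoin k S) F)) ≫ q = q')
    (e : Spec (.of F)) {N : ℕ}
    (h : (N : WithBot ℕ∞) ≤ topologicalKrullDim (closure {q' e})) :
    (N : ℕ∞) ≤ (AlgebraicIndependent.matroid k F).eRk S := by
  subst hq'
  obtain ⟨x, hx⟩ := exists_algebraicIndependent_of_le_topologicalKrullDim f q hq _ h
  exact hx.le_eRk_of_intermediateField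

theorem AlgebraicIndependent.exists_sum_of_le_eRk {k F ι κ : Type} [Field k] [Field F]
    [Algebra k F] {t : ι → F} {s : κ → F} {a b : ℕ}
    (ha : (a : ℕ∞) ≤ (AlgebraicIndependent.matroid k F).eRk (Set.range t))
    (hb : (b : ℕ∞) ≤ (AlgebraicIndependent.matroid k F).eRk (Set.range s))
    (hab : ((a + b : ℕ) : ℕ∞) ≤
      (AlgebraicIndependent.matroid k F).eRk (Set.range t ∪ Set.range s)) :
    ∃ (l : Fin a → ι) (m : Fin b → κ),
      AlgebraicIndependent k (Sum.elim (t ∘ l) (s ∘ m)) := by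
  obtain ⟨I, J, hI, hJ, hIa, hJb, hd, hind⟩ :=
    Matroid.exists_subsets_indep_union _ hb hab ha (Set.subset_univ _)
  have enum {A : Set F} {c : ℕ} (h : A.encard = c) : ∃ f : Fin c → F,
      Function.Injective f ∧ Set.range f = A := by
    have hf : A.Finite := Set.finite_of_encard_eq_coe h
    have : Fintype A := hf.fintype
    have hc : Fintype.card A = c := by
      rw [Set.encard_eq_coe_toFinset_card, Set.toFinset_card] at h
      exact_mod_cast h
    let e := (Fintype.equivFinOfCardEq hc).symm
    exact ⟨fun i ↦ (e i : F), Subtype.val_injective.comp e.injective, by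
      rw [← Function.comp_def, Set.range_comp, e.range_eq_univ]; simp⟩
  obtain ⟨f, hf, rfl⟩ := enum hIa
  obtain ⟨g, hg, rfl⟩ := enum hJb
  choose l hl using fun i ↦ hI ⟨i, rfl⟩
  choose m hm using fun i ↦ hJ ⟨i, rfl⟩
  refine ⟨l, m, ?_⟩
  rw [show t ∘ l = f from funext hl, show s ∘ m = g from funext hm]
  rw [← Set.Sum.elim_range] at hind
  refine (algebraicIndependent_subtype_range ?_).1 (AlgebraicIndependent.matroid_indep_iff.1 hind)
  refine hf.sumElim hg fun i j hij ↦ Set.disjoint_left.1 hd ⟨i, rfl⟩ ⟨j, hij.symm⟩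

section
variable {k : Type} [Field k] {n₁ n₂ : ℕ} {S : Type} [CommRing S] [Algebra k S]

/-- The `S`-point of a product of projective spaces with given pairs of coordinates. -/
def ProjSpace.pairPt (t : Fin (n₁ + 1) → S) (i : Fin (n₁ + 1)) (hi : IsUnit (t i))
    (s : Fin (n₂ + 1) → S) (j : Fin (n₂ + 1)) (hj : IsUnit (s j)) :
    Spec (.of S) ⟶ (ProjOver k n₁ ⨯ ProjOver k n₂).left :=
  (prod.lift
    (Over.homMk (ProjSpace.pt t i hi) (ProjSpace.pt_structMap t i hi) :
      Over.mk (Spec.map (CommRingCat.ofHom (algebraMap k S))) ⟶ ProjOver k n₁)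
    (Over.homMk (ProjSpace.pt s j hj) (ProjSpace.pt_structMap s j hj) :
      Over.mk (Spec.map (CommRingCat.ofHom (algebraMap k S))) ⟶ ProjOver k n₂)).left

variable (t : Fin (n₁ + 1) → S) (i : Fin (n₁ + 1)) (hi : IsUnit (t i))
    (s : Fin (n₂ + 1) → S) (j : Fin (n₂ + 1)) (hj : IsUnit (s j))

theorem ProjSpace.pairPt_fst : pairPt t i hi s j hj ≫
    (prod.fst : ProjOver k n₁ ⨯ ProjOver k n₂ ⟶ ProjOver k n₁).left = pt t i hi := by
  rw [pairPt, ← Over.comp_left, prod.lift_fst]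
  rfl

theorem ProjSpace.pairPt_snd : pairPt t i hi s j hj ≫
    (prod.snd : ProjOver k n₁ ⨯ ProjOver k n₂ ⟶ ProjOver k n₂).left = pt s j hj := by
  rw [pairPt, ← Over.comp_left, prod.lift_snd]
  rfl

theorem ProjSpace.pairPt_hom : pairPt t i hi s j hj ≫ (ProjOver k n₁ ⨯ ProjOver k n₂).hom =
    Spec.map (CommRingCat.ofHom (algebraMap k S)) := by
  rw [pairPt, Over.w]
  rfl
end

theorem CategoryTheory.Over.prod_hom_ext {B : Scheme.{0}} {X Y : Over B} {T : Scheme.{0}}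
    {f g : T ⟶ (X ⨯ Y).left}
    (h₁ : f ≫ (prod.fst : X ⨯ Y ⟶ X).left = g ≫ (prod.fst : X ⨯ Y ⟶ X).left)
    (h₂ : f ≫ (prod.snd : X ⨯ Y ⟶ Y).left = g ≫ (prod.snd : X ⨯ Y ⟶ Y).left) : f = g := by
  have hw : g ≫ (X ⨯ Y).hom = f ≫ (X ⨯ Y).hom := by
    rw [← Over.w (prod.fst : X ⨯ Y ⟶ X), reassoc_of% h₁]
  let f' : Over.mk (f ≫ (X ⨯ Y).hom) ⟶ X ⨯ Y := Over.homMk f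
  let g' : Over.mk (f ≫ (X ⨯ Y).hom) ⟶ X ⨯ Y := Over.homMk g hw
  have : f' = g' := prod.hom_ext (Over.OverMorphism.ext (by simpa [f', g'] using h₁))
    (Over.OverMorphism.ext (by simpa [f', g'] using h₂))
  exact congr_arg CommaMorphism.left this

theorem AlgebraicGeometry.locallyOfFiniteType_prod_hom {B : Scheme.{0}} (X Y : Over B)
    [LocallyOfFiniteType X.hom] [LocallyOfFiniteType Y.hom] :
    LocallyOfFiniteType (X ⨯ Y).hom := by
  rw [← Over.w (prod.fst : X ⨯ Y ⟶ X), ← Over.prodLeftIsoPullback_hom_fst]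
  infer_instance

theorem ProjSpace.exists_integral_coordinates {k K : Type} [Field k] [Field K] [Algebra k K]
    (V : ValuationSubring K) [Algebra k V] [IsScalarTower k V K] {x : K} (hx : x ∈ V.nonunits)
    {n a : ℕ} {t : Fin (n + 1) → K} {i₀ : Fin (n + 1)} (ht : t i₀ = 1) (l : Fin a → Fin (n + 1))
    {c : Fin a → MvPolynomial (Fin (n + 1)) k} (hc : ∀ i, (c i).IsHomogeneous 1)
    (h : ∀ i, x * t (l i) + aeval t (c i) ∈ V.nonunits) :
    ∃ (t' : Fin (n + 1) → V) (j : Fin (n + 1)) (u : K), t' j = 1 ∧ t j ≠ 0 ∧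
      (∀ m, (t' m : K) = u * t m) ∧ ∀ i, aeval t' (c i) ∈ IsLocalRing.maximalIdeal V := by
  obtain ⟨j, hj⟩ := Finite.exists_max fun m ↦ V.valuation (t m)
  have hj0 : t j ≠ 0 := fun h0 ↦ by
    have := hj i₀
    simp [h0, ht] at this
  have hmem (m) : (t j)⁻¹ * t m ∈ V := by
    rw [← V.valuation_le_one_iff, map_mul, map_inv₀]
    exact inv_mul_le_one_of_le₀ (hj m) zero_le
  let t' (m) : V := ⟨(t j)⁻¹ * t m, hmem m⟩
  refine ⟨t', j, (t j)⁻¹, Subtype.ext (inv_mul_cancel₀ hj0), hj0, fun _ ↦ rfl, fun i ↦ ?_⟩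
  obtain ⟨y, hy⟩ : ∃ y : V, (y : K) = x := ⟨⟨x, V.nonunits_subset hx⟩, rfl⟩
  obtain ⟨w, hw⟩ : ∃ y : V, (y : K) = x * t (l i) + aeval t (c i) :=
    ⟨⟨_, V.nonunits_subset (h i)⟩, rfl⟩
  have hyV : y ∈ IsLocalRing.maximalIdeal V := V.coe_mem_nonunits_iff.1 (hy ▸ hx)
  have hwV : w ∈ IsLocalRing.maximalIdeal V := V.coe_mem_nonunits_iff.1 (hw ▸ h i)
  have key : aeval t' (c i) = t' i₀ * w - y * t' (l i) := by
    apply Subtype.val_injective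
    have h1 : ((aeval t' (c i) : V) : K) = aeval (fun m ↦ (t j)⁻¹ * t m) (c i) :=
      (comp_aeval_apply t' (IsScalarTower.toAlgHom k V K) (c i))
    have h2 : aeval (fun m ↦ (t j)⁻¹ * t m) (c i) = (t j)⁻¹ ^ 1 * aeval t (c i) :=
      eval₂_mul_of_isHomogeneous (hc i) _ _ _
    have h3 : (w : K) = (y : K) * t (l i) + aeval t (c i) := by rw [hw, hy]
    rw [h1, h2]
    push_cast
    rw [h3]
    simp only [t', ht]
    ring
  rw [key]
  exact sub_mem (Ideal.mul_mem_left _ _ hwV) (Ideal.mul_mem_right _ _ hyV)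

theorem ProjSpace.specMap_comp_pt {k S S' : Type} [Field k] [CommRing S] [CommRing S']
    [Algebra k S] [Algebra k S'] [Algebra S S'] [IsScalarTower k S S'] {n : ℕ}
    (t : Fin (n + 1) → S) (j : Fin (n + 1)) (h : IsUnit (t j)) :
    Spec.map (CommRingCat.ofHom (algebraMap S S')) ≫ pt t j h =
      (pt (fun l ↦ algebraMap S S' (t l)) j (h.map (algebraMap S S')) : _ ⟶ ProjSpace k n) :=
  specMap_pt (IsScalarTower.toAlgHom k S S') t j h

theorem ProjSpace.specMap_comp_pairPt {k S S' : Type} [Field k] [CommRing S] [CommRing S']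
    [Algebra k S] [Algebra k S'] [Algebra S S'] [IsScalarTower k S S'] {n₁ n₂ : ℕ}
    (t : Fin (n₁ + 1) → S) (i : Fin (n₁ + 1)) (hi : IsUnit (t i))
    (s : Fin (n₂ + 1) → S) (j : Fin (n₂ + 1)) (hj : IsUnit (s j)) :
    Spec.map (CommRingCat.ofHom (algebraMap S S')) ≫
        (pairPt t i hi s j hj : _ ⟶ (ProjOver k n₁ ⨯ ProjOver k n₂).left) =
      pairPt (fun l ↦ algebraMap S S' (t l)) i (hi.map (algebraMap S S'))
        (fun l ↦ algebraMap S S' (s l)) j (hj.map (algebraMap S S')) :=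
  Over.prod_hom_ext
    (by rw [Category.assoc, pairPt_fst, pairPt_fst]; exact specMap_comp_pt ..)
    (by rw [Category.assoc, pairPt_snd, pairPt_snd]; exact specMap_comp_pt ..)

theorem ProjSpace.pairPt_eq_pairPt {k S : Type} [Field k] [CommRing S] [Algebra k S] {n₁ n₂ : ℕ}
    {t t' : Fin (n₁ + 1) → S} {s s' : Fin (n₂ + 1) → S} (u v : S) (hu : ∀ l, t' l = u * t l)
    (hv : ∀ l, s' l = v * s l) {i i' : Fin (n₁ + 1)} {j j' : Fin (n₂ + 1)}
    (hi : IsUnit (t i)) (hi' : IsUnit (t i')) (hi'' : IsUnit (t' i'))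
    (hj : IsUnit (s j)) (hj' : IsUnit (s j')) (hj'' : IsUnit (s' j')) :
    (pairPt t i hi s j hj : _ ⟶ (ProjOver k n₁ ⨯ ProjOver k n₂).left) =
      pairPt t' i' hi'' s' j' hj'' :=
  Over.prod_hom_ext
    (by
      rw [pairPt_fst, pairPt_fst, pt_eq_pt (t' := t) 1 (by simp) hi hi hi']
      exact pt_eq_pt u hu hi' hi'' hi'')
    (by
      rw [pairPt_snd, pairPt_snd, pt_eq_pt (t' := s) 1 (by simp) hj hj hj']
      exact pt_eq_pt v hv hj' hj'' hj'')

instance (k : Type) [Field k] (n₁ n₂ : ℕ) :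
    LocallyOfFiniteType (ProjOver k n₁ ⨯ ProjOver k n₂).hom :=
  have (n : ℕ) : LocallyOfFiniteType (ProjOver k n).hom :=
    inferInstanceAs (LocallyOfFiniteType (ProjSpace.structMap k n))
  locallyOfFiniteType_prod_hom _ _

section
variable {k F : Type} [Field k] [Field F] [Algebra k F] {n n₁ n₂ : ℕ}

theorem ProjSpace.le_eRk_range_of_le_topologicalKrullDim {t : Fin (n + 1) → F} {i : Fin (n + 1)}
    (ht : t i = 1) (hi : IsUnit (t i)) (e : Spec (.of F)) {N : ℕ}
    (h : (N : WithBot ℕ∞) ≤ topologicalKrullDim (closure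
      {(pt t i hi : _ ⟶ ProjSpace k n) e})) :
    (N : ℕ∞) ≤ (AlgebraicIndependent.matroid k F).eRk (Set.range t) := by
  let t' (l) : IntermediateField.adjoin k (Set.range t) :=
    ⟨t l, IntermediateField.subset_adjoin _ _ ⟨l, rfl⟩⟩
  exact le_eRk_of_le_topologicalKrullDim (structMap k n) (Set.range t)
    (pt t' i (.of_mul_eq_one 1 (Subtype.ext (by simp [t', ht])))) (pt_structMap ..) (pt t i hi)
    (specMap_comp_pt ..) e h

theorem ProjSpace.le_eRk_union_of_le_topologicalKrullDim {t : Fin (n₁ + 1) → F}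
    {i : Fin (n₁ + 1)} (ht : t i = 1) (hi : IsUnit (t i)) {s : Fin (n₂ + 1) → F}
    {j : Fin (n₂ + 1)} (hs : s j = 1) (hj : IsUnit (s j)) (e : Spec (.of F)) {N : ℕ}
    (h : (N : WithBot ℕ∞) ≤ topologicalKrullDim (closure
      {(pairPt t i hi s j hj : _ ⟶ (ProjOver k n₁ ⨯ ProjOver k n₂).left) e})) :
    (N : ℕ∞) ≤ (AlgebraicIndependent.matroid k F).eRk (Set.range t ∪ Set.range s) := by
  let t' (l) : IntermediateField.adjoin k (Set.range t ∪ Set.range s) :=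
    ⟨t l, IntermediateField.subset_adjoin _ _ (.inl ⟨l, rfl⟩)⟩
  let s' (l) : IntermediateField.adjoin k (Set.range t ∪ Set.range s) :=
    ⟨s l, IntermediateField.subset_adjoin _ _ (.inr ⟨l, rfl⟩)⟩
  exact le_eRk_of_le_topologicalKrullDim (ProjOver k n₁ ⨯ ProjOver k n₂).hom
    (Set.range t ∪ Set.range s)
    (pairPt t' i (.of_mul_eq_one 1 (Subtype.ext (by simp [t', ht])))
      s' j (.of_mul_eq_one 1 (Subtype.ext (by simp [s', hs]))))
    (pairPt_hom ..) (pairPt t i hi s j hj) (specMap_comp_pairPt ..) e h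

theorem ProjSpace.exists_mem_closure_of_algebraicIndependent {a b : ℕ}
    {t : Fin (n₁ + 1) → F} {i : Fin (n₁ + 1)} (ht : t i = 1) (hi : IsUnit (t i))
    {s : Fin (n₂ + 1) → F} {j : Fin (n₂ + 1)} (hs : s j = 1) (hj : IsUnit (s j))
    (l : Fin a → Fin (n₁ + 1)) (m : Fin b → Fin (n₂ + 1))
    (hind : AlgebraicIndependent k (Sum.elim (t ∘ l) (s ∘ m)))
    {σ : Fin a → MvPolynomial (Fin (n₁ + 1)) k} (hσ : ∀ i, (σ i).IsHomogeneous 1)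
    {τ : Fin b → MvPolynomial (Fin (n₂ + 1)) k} (hτ : ∀ j, (τ j).IsHomogeneous 1)
    (e : Spec (.of F)) :
    ∃ z ∈ closure {(pairPt t i hi s j hj : _ ⟶ (ProjOver k n₁ ⨯ ProjOver k n₂).left) e},
      (∀ i, σ i ∈ ((prod.fst : ProjOver k n₁ ⨯ ProjOver k n₂ ⟶ ProjOver k n₁).left
          z).asHomogeneousIdeal) ∧
      (∀ j, τ j ∈ ((prod.snd : ProjOver k n₁ ⨯ ProjOver k n₂ ⟶ ProjOver k n₂).left
          z).asHomogeneousIdeal) := by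
  obtain ⟨V, hkV, hX, hV⟩ := hind.exists_valuationSubring
    (Sum.elim (fun i ↦ aeval t (σ i)) (fun j ↦ aeval s (τ j)))
  let : Algebra k V := ((algebraMap k (RatFunc F)).codRestrict V.toSubring hkV).toAlgebra
  have : IsScalarTower k V (RatFunc F) := .of_algebraMap_eq fun _ ↦ rfl
  have hc {n : ℕ} (p : MvPolynomial (Fin (n + 1)) k) (t : Fin (n + 1) → F) :
      algebraMap F (RatFunc F) (aeval t p) = aeval (fun m ↦ algebraMap F (RatFunc F) (t m)) p :=
    comp_aeval_apply t (IsScalarTower.toAlgHom k F (RatFunc F)) p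
  obtain ⟨t', i', u, ht', hti, htu, htm⟩ := exists_integral_coordinates V hX
    (t := fun m ↦ algebraMap F (RatFunc F) (t m)) (i₀ := i) (by simp [ht]) l hσ
    (fun i ↦ by rw [← hc]; exact hV (.inl i))
  obtain ⟨s', j', v, hs', hsj, hsu, hsm⟩ := exists_integral_coordinates V hX
    (t := fun m ↦ algebraMap F (RatFunc F) (s m)) (i₀ := j) (by simp [hs]) m hτ
    (fun j ↦ by rw [← hc]; exact hV (.inr j))
  let g : Spec (.of V) ⟶ (ProjOver k n₁ ⨯ ProjOver k n₂).left :=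
    pairPt t' i' (ht' ▸ isUnit_one) s' j' (hs' ▸ isUnit_one)
  have hg : Spec.map (CommRingCat.ofHom (algebraMap F (RatFunc F))) ≫ pairPt t i hi s j hj =
      Spec.map (CommRingCat.ofHom (algebraMap V (RatFunc F))) ≫ g := by
    rw [specMap_comp_pairPt, specMap_comp_pairPt]
    exact pairPt_eq_pairPt u v htu hsu _ hti.isUnit _ _ hsj.isUnit _
  let e' : Spec (.of (RatFunc F)) := IsLocalRing.closedPoint (RatFunc F)
  let z : Spec (.of V) := IsLocalRing.closedPoint V
  refine ⟨g z, ?_, fun i ↦ ?_, fun j ↦ ?_⟩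
  · rw [← specializes_iff_mem_closure]
    have h1 : e = Spec.map (CommRingCat.ofHom (algebraMap F (RatFunc F))) e' :=
      Subsingleton.elim (α := PrimeSpectrum F) _ _
    rw [h1, ← Scheme.Hom.comp_apply, hg, Scheme.Hom.comp_apply]
    exact (IsLocalRing.specializes_closedPoint _).map g.continuous
  · rw [← Scheme.Hom.comp_apply, pairPt_fst, mem_asHomogeneousIdeal_pt_iff _ _ _ (hσ i)]
    exact htm i
  · rw [← Scheme.Hom.comp_apply, pairPt_snd, mem_asHomogeneousIdeal_pt_iff _ _ _ (hτ j)]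
    exact hsm j

end

/-- Let `k` be an algebraically closed field, `n₁, n₂ ≥ 1` and `r₁, r₂ > 0`.  Let
`C ⊆ ℙ^{n₁} ×_k ℙ^{n₂}` be a closed irreducible subvariety with `dim p₁(C) ≥ r₁ + 1`,
`dim p₂(C) ≥ r₂ + 1` and `dim C ≥ r₁ + r₂ + 2`.  Then for every choice of linear forms
`σ 0, …, σ r₁` (degree-one homogeneous polynomials in the coordinates of `ℙ^{n₁}`) and
`τ 0, …, τ r₂` (in the coordinates of `ℙ^{n₂}`) there is a point `z ∈ C` at which all of
them vanish: `σ i ∈ p₁(z)` and `τ j ∈ p₂(z)` as points of `Proj`.  Equivalently,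
`C ∩ (M₁ × M₂) ≠ ∅` where `M₁, M₂` are the common zero loci. -/
theorem exists_point_of_incidence
    (k : Type) [Field k] [IsAlgClosed k]
    (n₁ n₂ : ℕ) (hn₁ : 1 ≤ n₁) (hn₂ : 1 ≤ n₂)
    (r₁ r₂ : ℕ) (hr₁ : 0 < r₁) (hr₂ : 0 < r₂)
    (C : Set ((ProjOver k n₁ ⨯ ProjOver k n₂).left))
    (hCcl : IsClosed C) (hCirr : IsIrreducible C)
    (hdim₁ : ((r₁ + 1 : ℕ) : WithBot ℕ∞) ≤ topologicalKrullDim (closure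
      ((prod.fst : ProjOver k n₁ ⨯ ProjOver k n₂ ⟶ ProjOver k n₁).left.base '' C)))
    (hdim₂ : ((r₂ + 1 : ℕ) : WithBot ℕ∞) ≤ topologicalKrullDim (closure
      ((prod.snd : ProjOver k n₁ ⨯ ProjOver k n₂ ⟶ ProjOver k n₂).left.base '' C)))
    (hdimC : ((r₁ + r₂ + 2 : ℕ) : WithBot ℕ∞) ≤ topologicalKrullDim C)
    (σ : Fin (r₁ + 1) → MvPolynomial (Fin (n₁ + 1)) k)
    (hσ : ∀ i, (σ i).IsHomogeneous 1)
    (τ : Fin (r₂ + 1) → MvPolynomial (Fin (n₂ + 1)) k)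
    (hτ : ∀ j, (τ j).IsHomogeneous 1) :
    ∃ z ∈ C,
      (∀ i, σ i ∈
        (((prod.fst : ProjOver k n₁ ⨯ ProjOver k n₂ ⟶ ProjOver k n₁).left.base)
          z).asHomogeneousIdeal) ∧
      (∀ j, τ j ∈
        (((prod.snd : ProjOver k n₁ ⨯ ProjOver k n₂ ⟶ ProjOver k n₂).left.base)
          z).asHomogeneousIdeal) := by
  let p₁ := (prod.fst : ProjOver k n₁ ⨯ ProjOver k n₂ ⟶ ProjOver k n₁).left
  let p₂ := (prod.snd : ProjOver k n₁ ⨯ ProjOver k n₂ ⟶ ProjOver k n₂).left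
  let W := (ProjOver k n₁ ⨯ ProjOver k n₂).left
  let η : W := hCirr.genericPoint
  have hC : closure {η} = C := hCirr.isGenericPoint_genericPoint hCcl
  let F : Type := W.residueField η
  obtain ⟨φ, hφ⟩ := Spec.map_surjective
    (W.fromSpecResidueField η ≫ (ProjOver k n₁ ⨯ ProjOver k n₂).hom)
  let : Algebra k F := φ.hom.toAlgebra
  let q : Spec (.of F) ⟶ W := W.fromSpecResidueField η
  have hq : q ≫ (ProjOver k n₁ ⨯ ProjOver k n₂).hom =
    Spec.map (CommRingCat.ofHom (algebraMap k F)) := hφ.symm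
  let e : Spec (.of F) := IsLocalRing.closedPoint F
  have he : q e = η := Scheme.fromSpecResidueField_apply ..
  obtain ⟨t, i, hi, ht, hqt⟩ := ProjSpace.exists_eq_pt (q ≫ p₁) (by
    rw [← hq, Category.assoc]
    exact congr_arg (q ≫ ·) (Over.w prod.fst))
  obtain ⟨s, j, hj, hs, hqs⟩ := ProjSpace.exists_eq_pt (q ≫ p₂) (by
    rw [← hq, Category.assoc]
    exact congr_arg (q ≫ ·) (Over.w prod.snd))
  have hqp : q = ProjSpace.pairPt t i hi s j hj :=
    Over.prod_hom_ext (hqt.trans (ProjSpace.pairPt_fst ..).symm)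
      (hqs.trans (ProjSpace.pairPt_snd ..).symm)
  have himage {Y : Scheme.{0}} (p : W ⟶ Y) : closure (p '' C) = closure {(q ≫ p) e} := by
    rw [← hC, closure_image_closure p.continuous, Set.image_singleton, Scheme.Hom.comp_apply, he]
  have ha : ((r₁ + 1 : ℕ) : ℕ∞) ≤ _ :=
    ProjSpace.le_eRk_range_of_le_topologicalKrullDim (k := k) ht hi e
      (by rw [← hqt, ← himage]; exact hdim₁)
  have hb : ((r₂ + 1 : ℕ) : ℕ∞) ≤ _ :=
    ProjSpace.le_eRk_range_of_le_topologicalKrullDim (k := k) hs hj e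
      (by rw [← hqs, ← himage]; exact hdim₂)
  have hab : ((r₁ + 1 + (r₂ + 1) : ℕ) : ℕ∞) ≤ _ :=
    ProjSpace.le_eRk_union_of_le_topologicalKrullDim (k := k) ht hi hs hj e
      (by
        rw [← hqp, he, hC, show r₁ + 1 + (r₂ + 1) = r₁ + r₂ + 2 by ring]
        exact hdimC)
  obtain ⟨l, m, hind⟩ := AlgebraicIndependent.exists_sum_of_le_eRk ha hb hab
  obtain ⟨z, hz, h⟩ := ProjSpace.exists_mem_closure_of_algebraicIndependent ht hi hs hj l m hind
    hσ hτ e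
  exact ⟨z, by rwa [← hqp, he, hC] at hz, h⟩

end
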